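/- arXiv:2204.05150 — 2 statements merged into one kernel-verified Lean document; each statement's English description precedes it below -/
import Mathlib

section
/- Let H be a nonzero complex Hilbert space and let B, C be bounded linear operators on H. Then w_e(B, C)² ≤ min{ w(|B| + i|C|)·w(|B*| + i|C*|), w(|B| + i|C*|)·w(|B*| + i|C|) }. -/
open scoped InnerProductSpace
open ContinuousLinearMap

variable {H : Type*} [NormedAddCommGroup H] [InnerProductSpace ℂ H]
  [CompleteSpace H] [Nontrivial H]

/-- The numerical radius of a bounded linear operator. -/
noncomputable def numRad (A : H →L[ℂ] H) : ℝ :=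
  ⨆ x : {x : H // ‖x‖ = 1}, ‖⟪A x.1, x.1⟫_ℂ‖

/-- The Crawford number of a bounded linear operator. -/
noncomputable def crawford (A : H →L[ℂ] H) : ℝ :=
  ⨅ x : {x : H // ‖x‖ = 1}, ‖⟪A x.1, x.1⟫_ℂ‖

/-- The Euclidean operator radius of a pair of bounded linear operators. -/
noncomputable def euclRad (B C : H →L[ℂ] H) : ℝ :=
  ⨆ x : {x : H // ‖x‖ = 1}, Real.sqrt (‖⟪B x.1, x.1⟫_ℂ‖ ^ 2 + ‖⟪C x.1, x.1⟫_ℂ‖ ^ 2)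

/-- The absolute value `|A| = (A*A)^(1/2)` of a bounded linear operator. -/
noncomputable def opAbs (A : H →L[ℂ] H) : H →L[ℂ] H := CFC.sqrt (adjoint A * A)

/-- The real part `Re(A) = (A + A*)/2` of a bounded linear operator. -/
noncomputable def reOp (A : H →L[ℂ] H) : H →L[ℂ] H := (2 : ℂ)⁻¹ • (A + adjoint A)

/-- The imaginary part `Im(A) = (A - A*)/(2i)` of a bounded linear operator. -/
noncomputable def imOp (A : H →L[ℂ] H) : H →L[ℂ] H := (2 * Complex.I)⁻¹ • (A - adjoint A)

lemma mul_add_mul_le_sqrt_mul_sqrt (a b c d : ℝ) :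
    a * c + b * d ≤ √(a ^ 2 + b ^ 2) * √(c ^ 2 + d ^ 2) := by
  rw [← Real.sqrt_mul (by positivity)]
  exact Real.le_sqrt_of_sq_le (by nlinarith [sq_nonneg (a * d - b * c)])

section Radii

variable {E : Type*} [NormedAddCommGroup E] [InnerProductSpace ℂ E]

lemma norm_inner_le_numRad (A : E →L[ℂ] E) {x : E} (hx : ‖x‖ = 1) :
    ‖⟪A x, x⟫_ℂ‖ ≤ numRad A := by
  refine le_ciSup (f := fun x : {x : E // ‖x‖ = 1} => ‖⟪A x.1, x.1⟫_ℂ‖) ⟨‖A‖, ?_⟩ ⟨x, hx⟩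
  rintro _ ⟨⟨u, hu⟩, rfl⟩
  calc ‖⟪A u, u⟫_ℂ‖ ≤ ‖A u‖ * ‖u‖ := norm_inner_le_norm _ _
    _ ≤ ‖A‖ := by simpa [hu] using A.le_opNorm u

lemma numRad_nonneg (A : E →L[ℂ] E) : 0 ≤ numRad A :=
  Real.iSup_nonneg fun _ => norm_nonneg _

lemma sqrt_sq_add_sq_le_numRad {P Q : E →L[ℂ] E} (hP : 0 ≤ P) (hQ : 0 ≤ Q) {x : E}
    (hx : ‖x‖ = 1) :
    √((⟪x, P x⟫_ℂ).re ^ 2 + (⟪x, Q x⟫_ℂ).re ^ 2) ≤ numRad (P + Complex.I • Q) := by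
  have hreal {T : E →L[ℂ] E} (hT : 0 ≤ T) : ⟪T x, x⟫_ℂ = ((⟪x, T x⟫_ℂ).re : ℂ) := by
    have hpos := (nonneg_iff_isPositive T).mp hT
    rw [hpos.inner_left_eq_inner_right]
    exact Complex.eq_re_of_ofReal_le (r := 0) (by simpa using hpos.inner_nonneg_right x)
  refine le_trans (le_of_eq ?_) (norm_inner_le_numRad _ hx)
  rw [add_apply, smul_apply, inner_add_left, inner_smul_left, hreal hP, hreal hQ,
    Complex.norm_def, Complex.normSq_apply]
  simp [sq]

/-- A pointwise bound on the quadratic forms bounds the Euclidean operator radius. -/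
lemma euclRad_sq_le_numRad_mul_numRad {B C P Q R S : E →L[ℂ] E}
    (hP : 0 ≤ P) (hQ : 0 ≤ Q) (hR : 0 ≤ R) (hS : 0 ≤ S)
    (hB : ∀ x, ‖⟪B x, x⟫_ℂ‖ ^ 2 ≤ (⟪x, P x⟫_ℂ).re * (⟪x, R x⟫_ℂ).re)
    (hC : ∀ x, ‖⟪C x, x⟫_ℂ‖ ^ 2 ≤ (⟪x, Q x⟫_ℂ).re * (⟪x, S x⟫_ℂ).re) :
    euclRad B C ^ 2 ≤ numRad (P + Complex.I • Q) * numRad (R + Complex.I • S) := by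
  have hnonneg : 0 ≤ euclRad B C := Real.iSup_nonneg fun _ => Real.sqrt_nonneg _
  rw [← Real.le_sqrt hnonneg (mul_nonneg (numRad_nonneg _) (numRad_nonneg _))]
  refine Real.iSup_le (fun ⟨x, hx⟩ => Real.sqrt_le_sqrt ?_) (Real.sqrt_nonneg _)
  calc _ ≤ _ := add_le_add (hB x) (hC x)
    _ ≤ _ := mul_add_mul_le_sqrt_mul_sqrt _ _ _ _
    _ ≤ _ := mul_le_mul (sqrt_sq_add_sq_le_numRad hP hQ hx) (sqrt_sq_add_sq_le_numRad hR hS hx)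
      (Real.sqrt_nonneg _) (numRad_nonneg _)

variable [CompleteSpace E]

/-- Cauchy–Schwarz inequality for the form induced by a positive operator. -/
lemma norm_inner_sq_le_of_nonneg {R : E →L[ℂ] E} (hR : 0 ≤ R) (x z : E) :
    ‖⟪x, R z⟫_ℂ‖ ^ 2 ≤ (⟪x, R x⟫_ℂ).re * (⟪z, R z⟫_ℂ).re := by
  set s := CFC.sqrt R
  have hs : adjoint s = s := (IsSelfAdjoint.of_nonneg (CFC.sqrt_nonneg R)).star_eq
  have hinner (u v : E) : ⟪u, R v⟫_ℂ = ⟪s u, s v⟫_ℂ := by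
    have hv : R v = s (s v) :=
      DFunLike.congr_fun (CFC.sqrt_mul_sqrt_self R hR).symm v
    rw [hv, ← adjoint_inner_left, hs]
  have hnorm (u : E) : (⟪s u, s u⟫_ℂ).re = ‖s u‖ ^ 2 :=
    inner_self_eq_norm_sq (𝕜 := ℂ) (s u)
  rw [hinner, hinner, hinner, hnorm, hnorm, ← mul_pow]
  gcongr
  exact norm_inner_le_norm _ _

/-- A regularised form of the inequality `B |B|⁻¹ B* ≤ |B*|`. -/
lemma mul_inv_mul_adjoint_le_sqrt (B : E →L[ℂ] E) {R : (E →L[ℂ] E)ˣ} {ε : ℝ} (hε : 0 ≤ ε)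
    (hR : (R : E →L[ℂ] E) = CFC.sqrt (adjoint B * B) + ε • 1) :
    B * (↑R⁻¹ : E →L[ℂ] E) * adjoint B ≤ CFC.sqrt (B * adjoint B) := by
  set P := CFC.sqrt (adjoint B * B)
  have hP : 0 ≤ P := CFC.sqrt_nonneg _
  have hPP : P * P = adjoint B * B := CFC.sqrt_mul_sqrt_self _ (star_mul_self_nonneg B)
  have hεone : (0 : E →L[ℂ] E) ≤ ε • 1 := smul_nonneg hε zero_le_one
  have hRnonneg : (0 : E →L[ℂ] E) ≤ R := hR ▸ add_nonneg hP hεone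
  have hSnonneg : (0 : E →L[ℂ] E) ≤ ↑R⁻¹ := CFC.inv_nonneg_of_nonneg R hRnonneg
  have hSstar : star (↑R⁻¹ : E →L[ℂ] E) = ↑R⁻¹ := (IsSelfAdjoint.of_nonneg hSnonneg).star_eq
  have hPR : P * P ≤ (R : E →L[ℂ] E) * R := by
    have hexpand : (R : E →L[ℂ] E) * R = P * P + ((2 * ε) • P + (ε * ε) • 1) := by
      rw [hR]
      simp only [add_mul, mul_add, smul_mul_assoc, mul_smul_comm, one_mul, mul_one]
      module
    rw [hexpand]
    exact le_add_of_nonneg_right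
      (add_nonneg (smul_nonneg (by positivity) hP) (smul_nonneg (by positivity) zero_le_one))
  have hcontr : (↑R⁻¹ : E →L[ℂ] E) * (P * P) * ↑R⁻¹ ≤ 1 := by
    have h := star_left_conjugate_le_conjugate hPR (↑R⁻¹ : E →L[ℂ] E)
    rw [hSstar] at h
    simpa [mul_assoc] using h
  have hTnonneg : 0 ≤ B * (↑R⁻¹ : E →L[ℂ] E) * adjoint B :=
    star_right_conjugate_nonneg hSnonneg B
  rw [← CFC.sqrt_mul_self _ hTnonneg]
  refine CFC.sqrt_le_sqrt _ _ ?_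
  have h := star_right_conjugate_le_conjugate hcontr B
  rw [hPP, mul_one] at h
  simpa [mul_assoc, star_eq_adjoint] using h

/-- The mixed Schwarz inequality. -/
lemma norm_inner_sq_le_sqrt_mul_sqrt (B : E →L[ℂ] E) (x y : E) :
    ‖⟪B x, y⟫_ℂ‖ ^ 2 ≤ (⟪x, CFC.sqrt (adjoint B * B) x⟫_ℂ).re *
      (⟪y, CFC.sqrt (B * adjoint B) y⟫_ℂ).re := by
  set P := CFC.sqrt (adjoint B * B)
  set Q := CFC.sqrt (B * adjoint B)
  have hP : 0 ≤ P := CFC.sqrt_nonneg _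
  have hbound (ε : ℝ) (hε : 0 < ε) :
      ‖⟪B x, y⟫_ℂ‖ ^ 2 ≤ ((⟪x, P x⟫_ℂ).re + ε * ‖x‖ ^ 2) * (⟪y, Q y⟫_ℂ).re := by
    have hpos : IsStrictlyPositive (P + ε • (1 : E →L[ℂ] E)) :=
      (IsStrictlyPositive.smul hε isStrictlyPositive_one).nonneg_add hP
    obtain ⟨R, hR⟩ := hpos.isUnit
    have hle := mul_inv_mul_adjoint_le_sqrt B hε.le hR
    set z := (↑R⁻¹ : E →L[ℂ] E) (adjoint B y)
    have hRz : (R : E →L[ℂ] E) z = adjoint B y :=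
      DFunLike.congr_fun R.mul_inv (adjoint B y)
    have hRx : (⟪x, (R : E →L[ℂ] E) x⟫_ℂ).re = (⟪x, P x⟫_ℂ).re + ε * ‖x‖ ^ 2 := by
      have hself : (⟪x, x⟫_ℂ).re = ‖x‖ ^ 2 := inner_self_eq_norm_sq (𝕜 := ℂ) x
      rw [hR, add_apply, inner_add_right, Complex.add_re, smul_apply,
        one_apply_eq_self, inner_smul_right_eq_smul, Complex.smul_re, hself, smul_eq_mul]
    have hz : (⟪z, (R : E →L[ℂ] E) z⟫_ℂ).re ≤ (⟪y, Q y⟫_ℂ).re := by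
      have h := ((le_def _ _).mp hle).re_inner_nonneg_right y
      rw [sub_apply, inner_sub_right, map_sub, sub_nonneg] at h
      rw [hRz, adjoint_inner_right, ← RCLike.re_eq_complex_re, inner_re_symm]
      exact h
    calc ‖⟪B x, y⟫_ℂ‖ ^ 2 = ‖⟪x, (R : E →L[ℂ] E) z⟫_ℂ‖ ^ 2 := by
          rw [hRz, adjoint_inner_right]
      _ ≤ _ := norm_inner_sq_le_of_nonneg (hR ▸ hpos.nonneg) x z
      _ ≤ _ := by
          rw [hRx]
          have := ((nonneg_iff_isPositive P).mp hP).re_inner_nonneg_right x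
          rw [RCLike.re_eq_complex_re] at this
          gcongr
  have hlim : Filter.Tendsto
      (fun ε : ℝ => ((⟪x, P x⟫_ℂ).re + ε * ‖x‖ ^ 2) * (⟪y, Q y⟫_ℂ).re)
      (nhdsWithin 0 (Set.Ioi 0)) (nhds ((⟪x, P x⟫_ℂ).re * (⟪y, Q y⟫_ℂ).re)) := by
    refine Filter.Tendsto.mono_left ?_ nhdsWithin_le_nhds
    exact Continuous.tendsto' (by fun_prop) _ _ (by simp)
  exact ge_of_tendsto hlim (Filter.eventually_of_mem self_mem_nhdsWithin hbound)

lemma opAbs_nonneg (A : E →L[ℂ] E) : 0 ≤ opAbs A := CFC.sqrt_nonneg _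

lemma norm_inner_sq_le_opAbs (B : E →L[ℂ] E) (x : E) :
    ‖⟪B x, x⟫_ℂ‖ ^ 2 ≤ (⟪x, opAbs B x⟫_ℂ).re * (⟪x, opAbs (adjoint B) x⟫_ℂ).re := by
  simpa [opAbs] using norm_inner_sq_le_sqrt_mul_sqrt B x x

end Radii

theorem stmt1 (B C : H →L[ℂ] H) :
    (euclRad B C) ^ 2 ≤
      min (numRad (opAbs B + Complex.I • opAbs C) *
            numRad (opAbs (adjoint B) + Complex.I • opAbs (adjoint C)))
          (numRad (opAbs B + Complex.I • opAbs (adjoint C)) *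
            numRad (opAbs (adjoint B) + Complex.I • opAbs C)) := by
  refine le_min
    (euclRad_sq_le_numRad_mul_numRad (opAbs_nonneg _) (opAbs_nonneg _) (opAbs_nonneg _)
      (opAbs_nonneg _) (norm_inner_sq_le_opAbs B) (norm_inner_sq_le_opAbs C))
    (euclRad_sq_le_numRad_mul_numRad (opAbs_nonneg _) (opAbs_nonneg _) (opAbs_nonneg _)
      (opAbs_nonneg _) (norm_inner_sq_le_opAbs B) fun x => ?_)
  rw [mul_comm]
  exact norm_inner_sq_le_opAbs C x
end

section
/- Let H be a nonzero complex Hilbert space and let B, C be self-adjoint bounded linear operators on H. Then (1/2)·‖B² + C²‖ + (1/2)·max{‖B‖, ‖C‖}·| ‖B + C‖ − ‖B − C‖ | ≤ w_e(B, C)² ≤ w(|B| + i|C|)². -/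
open scoped InnerProductSpace
open ContinuousLinearMap

variable {H : Type*} [NormedAddCommGroup H] [InnerProductSpace ℂ H]
  [CompleteSpace H] [Nontrivial H]

/-- The quadratic form of a bounded operator is bounded by the norm on the unit sphere. -/
theorem norm_inner_apply_self_le_of_norm_eq_one {E : Type*} [NormedAddCommGroup E]
    [InnerProductSpace ℂ E] (A : E →L[ℂ] E) {x : E} (hx : ‖x‖ = 1) :
    ‖⟪A x, x⟫_ℂ‖ ≤ ‖A‖ := by
  have h := (norm_inner_le_norm (𝕜 := ℂ) (A x) x).trans
    (mul_le_mul_of_nonneg_right (A.le_opNorm x) (norm_nonneg x))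
  simpa [hx] using h

/-- The norm of a symmetric operator is controlled by its quadratic form on the unit sphere. -/
theorem LinearMap.IsSymmetric.opNorm_le_of_unit {E : Type*} [NormedAddCommGroup E]
    [InnerProductSpace ℂ E] {A : E →L[ℂ] E} (hA : (A : E →ₗ[ℂ] E).IsSymmetric) {M : ℝ}
    (hM : 0 ≤ M) (h : ∀ x : E, ‖x‖ = 1 → ‖⟪A x, x⟫_ℂ‖ ≤ M) : ‖A‖ ≤ M := by
  rw [A.norm_eq_iSup_rayleighQuotient hA]
  refine ciSup_le fun x => ?_
  rcases eq_or_ne x 0 with rfl | hx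
  · simpa using hM
  have hc : ((‖x‖⁻¹ : ℝ) : ℂ) ≠ 0 := by simpa using hx
  have hu : ‖((‖x‖⁻¹ : ℝ) : ℂ) • x‖ = 1 := by
    simp [norm_smul, hx]
  rw [← A.rayleigh_smul x hc, ContinuousLinearMap.rayleighQuotient, hu,
    ContinuousLinearMap.reApplyInnerSelf_apply, one_pow, div_one]
  exact (RCLike.abs_re_le_norm _).trans (h _ hu)

theorem euclRad_nonneg {E : Type*} [NormedAddCommGroup E]
    [InnerProductSpace ℂ E] (B C : E →L[ℂ] E) : 0 ≤ euclRad B C :=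
  Real.iSup_nonneg fun _ => Real.sqrt_nonneg _

theorem sq_add_sq_le_euclRad_sq {E : Type*} [NormedAddCommGroup E]
    [InnerProductSpace ℂ E] (B C : E →L[ℂ] E) {x : E} (hx : ‖x‖ = 1) :
    ‖⟪B x, x⟫_ℂ‖ ^ 2 + ‖⟪C x, x⟫_ℂ‖ ^ 2 ≤ euclRad B C ^ 2 := by
  rw [← Real.sqrt_le_left (euclRad_nonneg B C)]
  refine le_ciSup (f := fun x : {x : E // ‖x‖ = 1} =>
    √(‖⟪B x.1, x.1⟫_ℂ‖ ^ 2 + ‖⟪C x.1, x.1⟫_ℂ‖ ^ 2)) ⟨√(‖B‖ ^ 2 + ‖C‖ ^ 2), ?_⟩ ⟨x, hx⟩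
  rintro _ ⟨y, rfl⟩
  have hB := norm_inner_apply_self_le_of_norm_eq_one B y.2
  have hC := norm_inner_apply_self_le_of_norm_eq_one C y.2
  dsimp only
  gcongr

theorem norm_sq_le_two_mul_euclRad_sq {E : Type*} [NormedAddCommGroup E]
    [InnerProductSpace ℂ E] [CompleteSpace E] {A B C : E →L[ℂ] E} (hA : IsSelfAdjoint A)
    (h : ∀ x, ‖⟪A x, x⟫_ℂ‖ ≤ ‖⟪B x, x⟫_ℂ‖ + ‖⟪C x, x⟫_ℂ‖) :
    ‖A‖ ^ 2 ≤ 2 * euclRad B C ^ 2 := by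
  have hle : ‖A‖ ≤ √(2 * euclRad B C ^ 2) :=
    LinearMap.IsSymmetric.opNorm_le_of_unit hA.isSymmetric (Real.sqrt_nonneg _) fun x hx =>
      Real.le_sqrt_of_sq_le <| by
        have hsum := pow_le_pow_left₀ (norm_nonneg _) (h x) 2
        have hw := sq_add_sq_le_euclRad_sq B C hx
        linarith [add_sq_le (a := ‖⟪B x, x⟫_ℂ‖) (b := ‖⟪C x, x⟫_ℂ‖)]
  exact (Real.le_sqrt (norm_nonneg _) (by positivity)).1 hle

theorem norm_inner_apply_self_le_re_inner_opAbs {E : Type*} [NormedAddCommGroup E]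
    [InnerProductSpace ℂ E] [CompleteSpace E] {A : E →L[ℂ] E} (hA : IsSelfAdjoint A) (x : E) :
    ‖⟪A x, x⟫_ℂ‖ ≤ (⟪opAbs A x, x⟫_ℂ).re := by
  have h1 : (CFC.abs A - A).IsPositive := by
    rw [← ContinuousLinearMap.nonneg_iff_isPositive, CFC.abs_sub_self A hA]
    exact nsmul_nonneg (CFC.negPart_nonneg A) 2
  have h2 : (CFC.abs A + A).IsPositive := by
    rw [← ContinuousLinearMap.nonneg_iff_isPositive, CFC.abs_add_self A hA]
    exact nsmul_nonneg (CFC.posPart_nonneg A) 2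
  have e : opAbs A = CFC.abs A := rfl
  have h1 := h1.re_inner_nonneg_left x
  have h2 := h2.re_inner_nonneg_left x
  have e3 := hA.isSymmetric.coe_reApplyInnerSelf_apply x
  simp only [sub_apply, add_apply, inner_sub_left,
    inner_add_left, map_add, map_sub, RCLike.re_to_complex] at h1 h2
  rw [e, ← e3, RCLike.norm_ofReal, abs_le, ContinuousLinearMap.reApplyInnerSelf_apply,
    RCLike.re_to_complex]
  constructor <;> linarith

theorem opAbs_isPositive {E : Type*} [NormedAddCommGroup E]
    [InnerProductSpace ℂ E] [CompleteSpace E] (A : E →L[ℂ] E) : (opAbs A).IsPositive :=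
  (ContinuousLinearMap.nonneg_iff_isPositive _).1 (CFC.abs_nonneg A)

theorem norm_inner_add_I_smul_sq {E : Type*} [NormedAddCommGroup E] [InnerProductSpace ℂ E]
    {P Q : E →L[ℂ] E} (hP : (P : E →ₗ[ℂ] E).IsSymmetric) (hQ : (Q : E →ₗ[ℂ] E).IsSymmetric)
    (x : E) :
    ‖⟪(P + Complex.I • Q) x, x⟫_ℂ‖ ^ 2 = (⟪P x, x⟫_ℂ).re ^ 2 + (⟪Q x, x⟫_ℂ).re ^ 2 := by
  have hp : (⟪P x, x⟫_ℂ).im = 0 := hP.im_inner_apply_self x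
  have hq : (⟪Q x, x⟫_ℂ).im = 0 := hQ.im_inner_apply_self x
  rw [Complex.sq_norm, Complex.normSq_apply]
  simp [hp, hq]
  ring

theorem le_numRad {E : Type*} [NormedAddCommGroup E]
    [InnerProductSpace ℂ E] (A : E →L[ℂ] E) {x : E} (hx : ‖x‖ = 1) : ‖⟪A x, x⟫_ℂ‖ ≤ numRad A := by
  refine le_ciSup (f := fun x : {x : E // ‖x‖ = 1} => ‖⟪A x.1, x.1⟫_ℂ‖) ⟨‖A‖, ?_⟩ ⟨x, hx⟩
  rintro _ ⟨y, rfl⟩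
  exact norm_inner_apply_self_le_of_norm_eq_one A y.2

theorem euclRad_le_numRad_opAbs {E : Type*} [NormedAddCommGroup E]
    [InnerProductSpace ℂ E] [CompleteSpace E] {B C : E →L[ℂ] E}
    (hB : IsSelfAdjoint B) (hC : IsSelfAdjoint C) :
    euclRad B C ≤ numRad (opAbs B + Complex.I • opAbs C) := by
  refine Real.iSup_le (fun x => ?_) (Real.iSup_nonneg fun _ => norm_nonneg _)
  refine le_trans (Real.sqrt_le_iff.2 ⟨norm_nonneg _, ?_⟩) (le_numRad _ x.2)
  rw [norm_inner_add_I_smul_sq (opAbs_isPositive B).isSymmetric (opAbs_isPositive C).isSymmetric]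
  have h1 := norm_inner_apply_self_le_re_inner_opAbs hB x.1
  have h2 := norm_inner_apply_self_le_re_inner_opAbs hC x.1
  gcongr

theorem two_mul_norm_sq_add_sq_le {R : Type*} [NormedRing R] [NormedAlgebra ℝ R] (B C : R) :
    2 * ‖B ^ 2 + C ^ 2‖ ≤ ‖B + C‖ ^ 2 + ‖B - C‖ ^ 2 := by
  have e : (2 : ℝ) • (B ^ 2 + C ^ 2) = (B + C) ^ 2 + (B - C) ^ 2 := by
    rw [two_smul]; noncomm_ring
  calc 2 * ‖B ^ 2 + C ^ 2‖ = ‖(B + C) ^ 2 + (B - C) ^ 2‖ := by rw [← e, norm_smul]; simp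
    _ ≤ ‖(B + C) ^ 2‖ + ‖(B - C) ^ 2‖ := norm_add_le _ _
    _ ≤ _ := add_le_add (norm_pow_le' _ two_pos) (norm_pow_le' _ two_pos)

theorem two_mul_max_norm_le {V : Type*} [NormedAddCommGroup V] [NormedSpace ℝ V] (B C : V) :
    2 * max ‖B‖ ‖C‖ ≤ ‖B + C‖ + ‖B - C‖ := by
  have h1 : 2 * ‖B‖ ≤ ‖B + C‖ + ‖B - C‖ := by
    have e : (2 : ℝ) • B = (B + C) + (B - C) := by rw [two_smul]; abel
    simpa [← e, norm_smul] using norm_add_le (B + C) (B - C)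
  have h2 : 2 * ‖C‖ ≤ ‖B + C‖ + ‖B - C‖ := by
    have e : (2 : ℝ) • C = (B + C) - (B - C) := by rw [two_smul]; abel
    simpa [← e, norm_smul] using norm_sub_le (B + C) (B - C)
  rw [mul_max_of_nonneg _ _ zero_le_two]
  exact max_le h1 h2

theorem stmt4 (B C : H →L[ℂ] H) (hB : IsSelfAdjoint B) (hC : IsSelfAdjoint C) :
    (1/2) * ‖B ^ 2 + C ^ 2‖ + (1/2) * max ‖B‖ ‖C‖ * |‖B + C‖ - ‖B - C‖|
      ≤ (euclRad B C) ^ 2 ∧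
    (euclRad B C) ^ 2 ≤ (numRad (opAbs B + Complex.I • opAbs C)) ^ 2 := by
  refine ⟨?_, pow_le_pow_left₀ (euclRad_nonneg B C) (euclRad_le_numRad_opAbs hB hC) 2⟩
  have hp : ‖B + C‖ ^ 2 ≤ 2 * euclRad B C ^ 2 :=
    norm_sq_le_two_mul_euclRad_sq (hB.add hC) fun x => by
      simpa [inner_add_left] using norm_add_le ⟪B x, x⟫_ℂ ⟪C x, x⟫_ℂ
  have hq : ‖B - C‖ ^ 2 ≤ 2 * euclRad B C ^ 2 :=
    norm_sq_le_two_mul_euclRad_sq (hB.sub hC) fun x => by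
      simpa [inner_sub_left] using norm_sub_le ⟪B x, x⟫_ℂ ⟪C x, x⟫_ℂ
  have hs := two_mul_norm_sq_add_sq_le B C
  have hm := mul_le_mul_of_nonneg_right (two_mul_max_norm_le B C)
    (abs_nonneg (‖B + C‖ - ‖B - C‖))
  rcases abs_cases (‖B + C‖ - ‖B - C‖) with ⟨h, -⟩ | ⟨h, -⟩ <;> rw [h] at hm ⊢ <;> nlinarith
end
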